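/- arXiv:math/0608416 — 3 statements merged into one kernel-verified Lean document; each statement's English description precedes it below -/
import Mathlib

section
/- If X is an arc field on a metric space M satisfying Conditions E1 and E2 and a : M → ℝ is a Lipschitz function, then the arc field aX, defined by (aX)(x,t) := X(x, a(x)t) (with time truncated to [−1,1]), satisfies Conditions E1 and E2. -/
open Metric Set Asymptotics

/-- A metric space is *locally complete* if every point has a complete neighborhood. -/
def LocallyComplete (M : Type*) [MetricSpace M] : Prop :=
  ∀ x : M, ∃ s ∈ nhds x, IsComplete s

variable {M : Type*} [MetricSpace M]

/-- `X : M → ℝ → M` is an *arc field* (only the values for `t ∈ [-1,1]` are relevant):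
it is continuous, `X x 0 = x`, each arc `t ↦ X x t` is Lipschitz, and the Lipschitz
constant (the speed `ρ`) is locally bounded. -/
def IsArcField (X : M → ℝ → M) : Prop :=
  ContinuousOn (fun p : M × ℝ => X p.1 p.2) (univ ×ˢ Icc (-1 : ℝ) 1) ∧
  (∀ x, X x 0 = x) ∧
  (∀ x : M, ∃ r > (0 : ℝ), ∃ K > (0 : ℝ), ∀ y ∈ ball x r, ∀ s ∈ Icc (-1 : ℝ) 1,
      ∀ t ∈ Icc (-1 : ℝ) 1, dist (X y s) (X y t) ≤ K * |s - t|)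

/-- Condition E1. -/
def CondE1 (X : M → ℝ → M) : Prop :=
  ∀ x₀ : M, ∃ r > (0 : ℝ), ∃ δ > (0 : ℝ), ∃ Λ > (0 : ℝ),
    ∀ x ∈ ball x₀ r, ∀ y ∈ ball x₀ r, ∀ t : ℝ, |t| < δ →
      dist (X x t) (X y t) ≤ dist x y * (1 + |t| * Λ)

/-- Condition E2. -/
def CondE2 (X : M → ℝ → M) : Prop :=
  ∀ x₀ : M, ∃ r > (0 : ℝ), ∃ δ > (0 : ℝ), ∃ Ω > (0 : ℝ),
    ∀ x ∈ ball x₀ r, ∀ s t : ℝ, |s| < δ → |t| < δ →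
      dist (X x (s + t)) (X (X x s) t) ≤ |s * t| * Ω

/-- Two arc fields *close*: `d(Y_s X_t x, X_t Y_s x) = O(|st|)` locally uniformly. -/
def Close (X Y : M → ℝ → M) : Prop :=
  ∀ x₀ : M, ∃ C > (0 : ℝ), ∃ r > (0 : ℝ), ∃ δ > (0 : ℝ),
    ∀ x ∈ ball x₀ r, ∀ s t : ℝ, |s| < δ → |t| < δ →
      dist (Y (X x t) s) (X (Y x s) t) ≤ C * |s * t|

/-- `σ` is a solution curve of `X` on the open interval `I` (an open order-connected
set of reals containing `0`) with initial condition `x`. -/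
structure IsSolutionCurve (X : M → ℝ → M) (I : Set ℝ) (σ : ℝ → M) (x : M) : Prop where
  isOpen : IsOpen I
  ordConnected : I.OrdConnected
  zero_mem : (0 : ℝ) ∈ I
  init : σ 0 = x
  cont : ContinuousOn σ I
  tangent : ∀ t ∈ I,
    (fun h : ℝ => dist (σ (t + h)) (X (σ t) h)) =o[nhds (0 : ℝ)] fun h => h

/-- The sum of two arc fields: `(X+Y)_t x := Y_t (X_t x)`. -/
def sumArc (X Y : M → ℝ → M) (x : M) (t : ℝ) : M := Y (X x t) t

/-- The product of a function `a : M → ℝ` with an arc field: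
`(aX)(x,t) := X(x, a(x)·t)`, the time truncated to `[-1,1]`. -/
def smulArc (a : M → ℝ) (X : M → ℝ → M) (x : M) (t : ℝ) : M :=
  X x (max (-1) (min 1 (a x * t)))

/-- The bracket of two arc fields. -/
noncomputable def bracket (X Y : M → ℝ → M) (x : M) (t : ℝ) : M :=
  if 0 ≤ t then
    Y (X (Y (X x (Real.sqrt |t|)) (Real.sqrt |t|)) (-Real.sqrt |t|)) (-Real.sqrt |t|)
  else
    X (Y (X (Y x (Real.sqrt |t|)) (Real.sqrt |t|)) (-Real.sqrt |t|)) (-Real.sqrt |t|)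

/-- Local uniform tangency `Z ∼ W` of arc fields: `d(Z_t x, W_t x) = o(t)`
locally uniformly in `x`. -/
def LocUnifTangent (Z W : M → ℝ → M) : Prop :=
  ∀ x₀ : M, ∃ r > (0 : ℝ), ∀ ε > (0 : ℝ), ∃ δ > (0 : ℝ),
    ∀ x ∈ ball x₀ r, ∀ t : ℝ, 0 < |t| → |t| < δ → dist (Z x t) (W x t) ≤ ε * |t|

/-- Transversality of two arc fields. -/
def Transverse (X Y : M → ℝ → M) : Prop :=
  ∀ x₀ : M, ∃ δ > (0 : ℝ), ∀ x ∈ ball x₀ δ, ∀ s t : ℝ, |s| < δ → |t| < δ →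
    δ * (|s| + |t|) ≤ dist (X x s) (Y x t)

/-- A set `S` is locally uniformly tangent to the arc field `Z`:
`d(Z_t x, S) = o(t)` locally uniformly for `x ∈ S`. -/
def SetTangentTo (S : Set M) (Z : M → ℝ → M) : Prop :=
  ∀ x₀ ∈ S, ∃ r > (0 : ℝ), ∀ ε > (0 : ℝ), ∃ δ > (0 : ℝ), ∀ x ∈ S ∩ ball x₀ r,
    ∀ t : ℝ, 0 < |t| → |t| < δ → Metric.infDist (Z x t) S ≤ ε * |t|

/-- `S` is an integral surface of the arc fields `X` and `Y`: a 2-dimensional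
topological manifold locally uniformly tangent to `aX + bY` for all Lipschitz `a b`. -/
def IsIntegralSurface (X Y : M → ℝ → M) (S : Set M) : Prop :=
  Nonempty (ChartedSpace (EuclideanSpace ℝ (Fin 2)) S) ∧
  ∀ a b : M → ℝ, (∃ K, LipschitzWith K a) → (∃ K, LipschitzWith K b) →
    SetTangentTo S (sumArc (smulArc a X) (smulArc b Y))

/-- The bracket of two local flows `F`, `G` (with time domains `IF x`, `IG x`)
is defined at `(x,t)` if all needed times lie in the relevant domains. -/
noncomputable def FlowBracketDefined (F G : M → ℝ → M) (IF IG : M → Set ℝ)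
    (x : M) (t : ℝ) : Prop :=
  if 0 ≤ t then
    Real.sqrt |t| ∈ IF x ∧ Real.sqrt |t| ∈ IG (F x (Real.sqrt |t|)) ∧
      (-Real.sqrt |t|) ∈ IF (G (F x (Real.sqrt |t|)) (Real.sqrt |t|)) ∧
      (-Real.sqrt |t|) ∈ IG (F (G (F x (Real.sqrt |t|)) (Real.sqrt |t|)) (-Real.sqrt |t|))
  else
    Real.sqrt |t| ∈ IG x ∧ Real.sqrt |t| ∈ IF (G x (Real.sqrt |t|)) ∧
      (-Real.sqrt |t|) ∈ IG (F (G x (Real.sqrt |t|)) (Real.sqrt |t|)) ∧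
      (-Real.sqrt |t|) ∈ IF (G (F (G x (Real.sqrt |t|)) (Real.sqrt |t|)) (-Real.sqrt |t|))

/-- Local uniform tangency of the bracket of two local flows to an arc field `W`,
required only where the bracket is defined. -/
noncomputable def FlowBracketTangent (F G : M → ℝ → M) (IF IG : M → Set ℝ)
    (W : M → ℝ → M) : Prop :=
  ∀ x₀ : M, ∃ r > (0 : ℝ), ∀ ε > (0 : ℝ), ∃ δ > (0 : ℝ), ∀ x ∈ ball x₀ r, ∀ t : ℝ,
    0 < |t| → |t| < δ → FlowBracketDefined F G IF IG x t →
      dist (bracket F G x t) (W x t) ≤ ε * |t|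

/-- Linear speed growth of an arc field. -/
def LinearSpeedGrowth (X : M → ℝ → M) : Prop :=
  ∃ x : M, ∃ c₁ > (0 : ℝ), ∃ c₂ > (0 : ℝ), ∀ r > (0 : ℝ), ∀ y ∈ ball x r,
    ∀ s ∈ Icc (-1 : ℝ) 1, ∀ t ∈ Icc (-1 : ℝ) 1,
      dist (X y s) (X y t) ≤ (c₁ * r + c₂) * |s - t|

/-- Iterated sum of a list of arc fields. -/
def comboList : List (M → ℝ → M) → M → ℝ → M
  | [], x, _ => x
  | Z :: L, x, t => comboList L (Z x t) t

/-- The linear combination `a₁X¹ + ⋯ + aₙXⁿ` of arc fields. -/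
def combo {n : ℕ} (X : Fin n → M → ℝ → M) (a : Fin n → M → ℝ) : M → ℝ → M :=
  comboList (List.ofFn fun i => smulArc (a i) (X i))

/-- The distance from `y` to the set of curves through `x` of the linear span
distribution `Δ(X¹,…,Xⁿ)`. -/
noncomputable def distToSpan {n : ℕ} (X : Fin n → M → ℝ → M) (y x : M) : ℝ :=
  sInf {r : ℝ | ∃ (a : Fin n → ℝ) (s : ℝ), s ∈ Icc (-1 : ℝ) 1 ∧
    r = dist y (combo X (fun i _ => a i) x s)}

/-- Local uniform tangency of an arc field to the distribution `Δ(X¹,…,Xⁿ)`. -/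
noncomputable def TangentToSpan {n : ℕ} (Z : M → ℝ → M) (X : Fin n → M → ℝ → M) : Prop :=
  ∀ x₀ : M, ∃ r > (0 : ℝ), ∀ ε > (0 : ℝ), ∃ δ > (0 : ℝ), ∀ x ∈ ball x₀ r, ∀ t : ℝ,
    0 < |t| → |t| < δ → distToSpan X (Z x t) x ≤ ε * |t|

/-- The family `X¹,…,Xⁿ` is transverse: each `Xⁱ` is transverse to the linear span
of the remaining arc fields (encoded by coefficient functions vanishing at slot `i`). -/
def TransverseFamily {n : ℕ} (X : Fin n → M → ℝ → M) : Prop :=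
  ∀ i : Fin n, ∀ x₀ : M, ∃ δ > (0 : ℝ), ∀ x ∈ ball x₀ δ, ∀ a : Fin n → ℝ, a i = 0 →
    ∀ s t : ℝ, |s| < δ → |t| < δ →
      δ * (|s| + |t|) ≤ dist (X i x t) (combo X (fun j _ => a j) x s)

/-- Involutivity of the distribution `Δ(X¹,…,Xⁿ)`. -/
noncomputable def InvolutiveFamily {n : ℕ} (X : Fin n → M → ℝ → M) : Prop :=
  ∀ i j : Fin n, TangentToSpan (bracket (X i) (X j)) X

/-- `S` is an integral surface for the distribution `Δ(X¹,…,Xⁿ)`. -/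
def IsIntegralSurfaceFamily {n : ℕ} (X : Fin n → M → ℝ → M) (S : Set M) : Prop :=
  Nonempty (ChartedSpace (EuclideanSpace ℝ (Fin n)) S) ∧
  ∀ a : Fin n → M → ℝ, (∀ i, ∃ K, LipschitzWith K (a i)) →
    SetTangentTo S (combo X a)

theorem smulArc_eq_of_abs_le_one {M : Type*} [MetricSpace M] {X : M → ℝ → M} {a : M → ℝ}
    {x : M} {t : ℝ} (h : |a x * t| ≤ 1) : smulArc a X x t = X x (a x * t) := by
  obtain ⟨h₁, h₂⟩ := abs_le.mp h
  rw [smulArc, min_eq_right h₂, max_eq_right h₁]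

theorem exists_abs_le_on_ball_of_lipschitz {M : Type*} [MetricSpace M] {a : M → ℝ} {L : NNReal}
    (ha : LipschitzWith L a) (x₀ : M) (r : ℝ) :
    ∃ A > (0 : ℝ), ∀ x ∈ ball x₀ r, |a x| ≤ A := by
  refine ⟨|a x₀| + L * |r| + 1, by positivity, fun x hx => ?_⟩
  have h₁ : |a x - a x₀| ≤ L * dist x x₀ := by
    simpa [Real.dist_eq] using ha.dist_le_mul x x₀
  have h₂ : (L : ℝ) * dist x x₀ ≤ L * |r| :=
    mul_le_mul_of_nonneg_left ((mem_ball.mp hx).le.trans (le_abs_self r)) L.coe_nonneg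
  have h₃ := abs_sub_abs_le_abs_sub (a x) (a x₀)
  linarith

theorem abs_mul_lt_of_abs_le {A b t δ : ℝ} (hA : 0 < A) (hb : |b| ≤ A) (ht : |t| < δ / A) :
    |b * t| < δ := by
  rw [lt_div_iff₀ hA] at ht
  rw [abs_mul]
  nlinarith [abs_nonneg t]

theorem condE1_smulArc {M : Type*} [MetricSpace M] {X : M → ℝ → M}
    (hX : IsArcField X) (hXE1 : CondE1 X) {a : M → ℝ} {L : NNReal} (ha : LipschitzWith L a) :
    CondE1 (smulArc a X) := by
  intro x₀
  obtain ⟨r₁, hr₁, δ₁, hδ₁, Λ, hΛ, hE⟩ := hXE1 x₀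
  obtain ⟨r₂, hr₂, K, hK, hρ⟩ := hX.2.2 x₀
  obtain ⟨A, hA, haA⟩ := exists_abs_le_on_ball_of_lipschitz ha x₀ (min r₁ r₂)
  refine ⟨min r₁ r₂, by positivity, min 1 δ₁ / A, by positivity, K * L + A * Λ, by positivity,
    fun x hx y hy t ht => ?_⟩
  have htx := abs_mul_lt_of_abs_le hA (haA x hx) ht
  have hty := abs_mul_lt_of_abs_le hA (haA y hy) ht
  have htx1 := htx.le.trans (min_le_left _ _)
  have hty1 := hty.le.trans (min_le_left _ _)
  rw [smulArc_eq_of_abs_le_one htx1, smulArc_eq_of_abs_le_one hty1]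
  have hspeed := hρ x (ball_subset_ball (min_le_right _ _) hx) _ (abs_le.mp htx1) _
    (abs_le.mp hty1)
  have hspace := hE x (ball_subset_ball (min_le_left _ _) hx) y
    (ball_subset_ball (min_le_left _ _) hy) _ (hty.trans_le (min_le_right _ _))
  have hlip : |a x - a y| ≤ L * dist x y := by
    simpa [Real.dist_eq] using ha.dist_le_mul x y
  rw [← sub_mul, abs_mul] at hspeed
  rw [abs_mul] at hspace
  calc dist (X x (a x * t)) (X y (a y * t))
      ≤ dist (X x (a x * t)) (X x (a y * t)) + dist (X x (a y * t)) (X y (a y * t)) :=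
        dist_triangle _ _ _
    _ ≤ K * (|a x - a y| * |t|) + dist x y * (1 + |a y| * |t| * Λ) := add_le_add hspeed hspace
    _ ≤ K * (L * dist x y * |t|) + dist x y * (1 + A * |t| * Λ) := by
        gcongr
        exact haA y hy
    _ = dist x y * (1 + |t| * (K * L + A * Λ)) := by ring

theorem condE2_smulArc {M : Type*} [MetricSpace M] {X : M → ℝ → M}
    (hX : IsArcField X) (hXE2 : CondE2 X) {a : M → ℝ} {L : NNReal} (ha : LipschitzWith L a) :
    CondE2 (smulArc a X) := by
  intro x₀
  obtain ⟨r₁, hr₁, δ₁, hδ₁, Ω, hΩ, hE⟩ := hXE2 x₀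
  obtain ⟨r₂, hr₂, K, hK, hρ⟩ := hX.2.2 x₀
  obtain ⟨A, hA, haA⟩ := exists_abs_le_on_ball_of_lipschitz ha x₀ (min r₁ r₂)
  set R := min r₁ r₂
  have hR0 : 0 < R := by positivity
  refine ⟨R / 2, by positivity, min (1 / 2) (min δ₁ (R / 2 / K)) / A, by positivity,
    A * A * Ω + K * (L * (K * A)), by positivity, fun x hx s t hs ht => ?_⟩
  have hxR : x ∈ ball x₀ R := ball_subset_ball (by linarith) hx
  have hs' := abs_mul_lt_of_abs_le hA (haA x hxR) hs
  have ht' := abs_mul_lt_of_abs_le hA (haA x hxR) ht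
  obtain ⟨hs1, hsδ, hsR⟩ := by simpa only [lt_min_iff] using hs'
  obtain ⟨ht1, htδ, -⟩ := by simpa only [lt_min_iff] using ht'
  have hs1' : |a x * s| ≤ 1 := by linarith
  have ht1' : |a x * t| ≤ 1 := by linarith
  have hst1 : |a x * (s + t)| ≤ 1 := by
    rw [mul_add]
    linarith [abs_add_le (a x * s) (a x * t)]
  rw [smulArc_eq_of_abs_le_one hst1, smulArc_eq_of_abs_le_one hs1', mul_add]
  have hmove : dist x (X x (a x * s)) ≤ K * |a x * s| := by
    have h := hρ x (ball_subset_ball (min_le_right _ _) hxR) 0 (by simp) _ (abs_le.mp hs1')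
    rwa [hX.2.1, zero_sub, abs_neg] at h
  have hflow := hE x (ball_subset_ball (min_le_left _ _) hxR) _ _ hsδ htδ
  set y := X x (a x * s)
  have hyR : y ∈ ball x₀ R := by
    rw [lt_div_iff₀ hK] at hsR
    rw [mem_ball] at hx ⊢
    linarith [dist_triangle_left y x₀ x]
  have hty1 : |a y * t| ≤ 1 := by
    linarith [(abs_mul_lt_of_abs_le hA (haA y hyR) ht).trans_le (min_le_left _ _)]
  rw [smulArc_eq_of_abs_le_one hty1]
  have hspeed := hρ y (ball_subset_ball (min_le_right _ _) hyR) _ (abs_le.mp ht1') _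
    (abs_le.mp hty1)
  have hlip : |a x - a y| ≤ L * dist x y := by
    simpa [Real.dist_eq] using ha.dist_le_mul x y
  rw [← sub_mul, abs_mul] at hspeed
  rw [abs_mul] at hmove
  rw [abs_mul, abs_mul, abs_mul] at hflow
  have haxA := haA x hxR
  calc dist (X x (a x * s + a x * t)) (X y (a y * t))
      ≤ dist (X x (a x * s + a x * t)) (X y (a x * t)) + dist (X y (a x * t)) (X y (a y * t)) :=
        dist_triangle _ _ _
    _ ≤ |a x| * |s| * (|a x| * |t|) * Ω + K * (|a x - a y| * |t|) := add_le_add hflow hspeed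
    _ ≤ |a x| * |s| * (|a x| * |t|) * Ω + K * (L * (K * (|a x| * |s|)) * |t|) := by
        gcongr
        exact hlip.trans (mul_le_mul_of_nonneg_left hmove L.coe_nonneg)
    _ ≤ A * |s| * (A * |t|) * Ω + K * (L * (K * (A * |s|)) * |t|) := by gcongr
    _ = |s * t| * (A * A * Ω + K * (L * (K * A))) := by rw [abs_mul]; ring

/-- if `X` satisfies E1 and E2 and `a : M → ℝ` is Lipschitz, then
the arc field `aX`, `(aX)(x,t) := X(x, a(x)t)` (time truncated to `[-1,1]`),
satisfies E1 and E2. -/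
theorem smulArc_satisfies_E1_E2
    {M : Type*} [MetricSpace M] (X : M → ℝ → M)
    (hX : IsArcField X) (hXE1 : CondE1 X) (hXE2 : CondE2 X)
    (a : M → ℝ) (ha : ∃ K, LipschitzWith K a) :
    CondE1 (smulArc a X) ∧ CondE2 (smulArc a X) := by
  obtain ⟨L, hL⟩ := ha
  exact ⟨condE1_smulArc hX hXE1 hL, condE2_smulArc hX hXE2 hL⟩
end

section
/- Let φ : M₁ → M₂ be a lipeomorphism between metric spaces and let X be an arc field on M₂ having a unique solution curve through each point. Then the pull-back arc field φ*X on M₁, defined by (φ*X)_t(x) := φ⁻¹(X_t(φ(x))), has a unique solution curve through each point, and the solution curves of φ*X are exactly the pull-backs t ↦ φ⁻¹(σ_{φ(x)}(t)) of the solution curves σ of X. -/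
open Metric Set Asymptotics

variable {M : Type*} [MetricSpace M]

/-- The image of a solution curve under a Lipschitz map `g` with left inverse `f` solves the
arc field transported along `g`. -/
theorem IsSolutionCurve.map {N P : Type*} [MetricSpace N] [MetricSpace P]
    {f : N → P} {g : P → N} (hfg : Function.LeftInverse f g) {K : NNReal}
    (hg : LipschitzWith K g) {X : P → ℝ → P} {I : Set ℝ} {σ : ℝ → P} {x : P}
    (h : IsSolutionCurve X I σ x) :
    IsSolutionCurve (fun z t => g (X (f z) t)) I (fun t => g (σ t)) (g x) where
  isOpen := h.isOpen
  ordConnected := h.ordConnected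
  zero_mem := h.zero_mem
  init := congrArg g h.init
  cont := hg.continuous.comp_continuousOn h.cont
  tangent t ht := by
    refine (IsBigO.of_bound (K : ℝ) (Filter.Eventually.of_forall fun s => ?_)).trans_isLittleO
      (h.tangent t ht)
    simpa [hfg (σ t)] using hg.dist_le_mul (σ (t + s)) (X (σ t) s)

/-- the pull-back of an arc field with unique solution curves along
a lipeomorphism has unique solution curves, and its solutions are exactly the
pull-backs of the solutions of the original arc field. -/
theorem pullback_solutions
    {M₁ M₂ : Type*} [MetricSpace M₁] [MetricSpace M₂]
    (φ : M₁ → M₂) (ψ : M₂ → M₁)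
    (hleft : Function.LeftInverse ψ φ) (hright : Function.RightInverse ψ φ)
    (Kφ Kψ : NNReal) (hφ : LipschitzWith Kφ φ) (hψ : LipschitzWith Kψ ψ)
    (X : M₂ → ℝ → M₂) (hX : IsArcField X)
    (hXsol : ∀ y : M₂, ∃ (I : Set ℝ) (σ : ℝ → M₂), IsSolutionCurve X I σ y ∧
      ∀ (J : Set ℝ) (τ : ℝ → M₂), IsSolutionCurve X J τ y →
        J ⊆ I ∧ Set.EqOn τ σ J) :
    (∀ x : M₁, ∃ (I : Set ℝ) (σ : ℝ → M₁),
        IsSolutionCurve (fun z t => ψ (X (φ z) t)) I σ x ∧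
        ∀ (J : Set ℝ) (τ : ℝ → M₁),
          IsSolutionCurve (fun z t => ψ (X (φ z) t)) J τ x →
            J ⊆ I ∧ Set.EqOn τ σ J) ∧
    (∀ (x : M₁) (I : Set ℝ) (σ : ℝ → M₁),
        IsSolutionCurve (fun z t => ψ (X (φ z) t)) I σ x ↔
          IsSolutionCurve X I (fun t => φ (σ t)) (φ x)) := by
  have hiff : ∀ (x : M₁) (I : Set ℝ) (σ : ℝ → M₁),
      IsSolutionCurve (fun z t => ψ (X (φ z) t)) I σ x ↔
        IsSolutionCurve X I (fun t => φ (σ t)) (φ x) := fun x I σ =>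
    ⟨fun h => by simpa only [hright _] using h.map hleft hφ,
      fun h => by simpa only [hleft _] using h.map hright hψ⟩
  refine ⟨fun x => ?_, hiff⟩
  obtain ⟨I, σ, hσ, huniq⟩ := hXsol (φ x)
  refine ⟨I, fun t => ψ (σ t), by simpa only [hleft _] using hσ.map hright hψ,
    fun J τ hτ => ?_⟩
  obtain ⟨hJI, heq⟩ := huniq J _ ((hiff x J τ).1 hτ)
  exact ⟨hJI, fun t ht => (hleft (τ t)).symm.trans (congrArg ψ (heq ht))⟩
end

section
/- Let X be an arc field satisfying Conditions E1 and E2 on a locally complete metric space M, and let F be its local flow. Then for each fixed s, the pull-back (F_s)*X, defined by ((F_s)*X)_t(x) := F_{−s}(X_t(F_s(x))) wherever defined, is locally uniformly tangent to X: d(F_{−s}(X_t(F_s(x))), X_t(x)) = o(t) locally uniformly in x. -/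
open Metric Set Asymptotics

variable {M : Type*} [MetricSpace M]

open Filter Topology

/-- Uniform versions, on the set `U`, of Conditions E1 and E2 and of the speed bound. -/
structure LocalBounds (X : M → ℝ → M) (U : Set M) (δ L : ℝ) : Prop where
  lipschitz : ∀ x ∈ U, ∀ y ∈ U, ∀ t : ℝ, |t| < δ →
    dist (X x t) (X y t) ≤ dist x y * (1 + |t| * L)
  semigroup : ∀ x ∈ U, ∀ s t : ℝ, |s| < δ → |t| < δ →
    dist (X x (s + t)) (X (X x s) t) ≤ |s * t| * L
  speed : ∀ x ∈ U, ∀ s t : ℝ, |s| < δ → |t| < δ → dist (X x s) (X x t) ≤ L * |s - t|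

theorem LocalBounds.mono {X : M → ℝ → M} {U V : Set M} {δ δ' L L' : ℝ}
    (h : LocalBounds X U δ L) (hV : V ⊆ U) (hδ : δ' ≤ δ) (hL : L ≤ L') :
    LocalBounds X V δ' L' where
  lipschitz x hx y hy t ht :=
    (h.lipschitz x (hV hx) y (hV hy) t (ht.trans_le hδ)).trans (by gcongr)
  semigroup x hx s t hs ht :=
    (h.semigroup x (hV hx) s t (hs.trans_le hδ) (ht.trans_le hδ)).trans (by gcongr)
  speed x hx s t hs ht :=
    (h.speed x (hV hx) s t (hs.trans_le hδ) (ht.trans_le hδ)).trans (by gcongr)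

theorem LocalBounds.reverse {X : M → ℝ → M} {U : Set M} {δ L : ℝ} (h : LocalBounds X U δ L) :
    LocalBounds (fun x t => X x (-t)) U δ L where
  lipschitz x hx y hy t ht := by
    simpa using h.lipschitz x hx y hy (-t) (by simpa using ht)
  semigroup x hx s t hs ht := by
    simpa [neg_add, add_comm] using
      h.semigroup x hx (-s) (-t) (by simpa using hs) (by simpa using ht)
  speed x hx s t hs ht := by
    have := h.speed x hx (-s) (-t) (by simpa using hs) (by simpa using ht)
    rwa [neg_sub_neg, abs_sub_comm] at this

theorem exists_localBounds_ball {X : M → ℝ → M} (hX : IsArcField X) (hE1 : CondE1 X)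
    (hE2 : CondE2 X) (z : M) :
    ∃ r > (0 : ℝ), ∃ δ > (0 : ℝ), ∃ L > (0 : ℝ), LocalBounds X (ball z r) δ L := by
  obtain ⟨r₁, hr₁, δ₁, hδ₁, Λ, hΛ, h₁⟩ := hE1 z
  obtain ⟨r₂, hr₂, δ₂, hδ₂, Ω, hΩ, h₂⟩ := hE2 z
  obtain ⟨r₃, hr₃, K, hK, h₃⟩ := hX.2.2 z
  refine ⟨min r₁ (min r₂ r₃), by positivity, min δ₁ (min δ₂ 1), by positivity,
    max Λ (max Ω K), by positivity, ?_, ?_, ?_⟩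
  · intro x hx y hy t ht
    simp only [mem_ball, lt_min_iff] at hx hy ht
    refine (h₁ x hx.1 y hy.1 t ht.1).trans ?_
    gcongr
    exact le_max_left _ _
  · intro x hx s t hs ht
    simp only [mem_ball, lt_min_iff] at hx hs ht
    refine (h₂ x hx.2.1 s t hs.2.1 ht.2.1).trans ?_
    gcongr
    exact (le_max_left _ _).trans (le_max_right _ _)
  · intro x hx s t hs ht
    simp only [mem_ball, lt_min_iff] at hx hs ht
    refine (h₃ x hx.2.2 s (abs_le.1 hs.2.2.le) t (abs_le.1 ht.2.2.le)).trans ?_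
    gcongr
    exact (le_max_right _ _).trans (le_max_right _ _)

theorem IsCompact.exists_localBounds {X : M → ℝ → M} {K : Set M} (hK : IsCompact K)
    (h : ∀ z ∈ K, ∃ r > (0 : ℝ), ∃ δ > (0 : ℝ), ∃ L > (0 : ℝ), LocalBounds X (ball z r) δ L) :
    ∃ r > (0 : ℝ), ∃ δ > (0 : ℝ), ∃ L > (0 : ℝ), ∀ z ∈ K, LocalBounds X (ball z r) δ L := by
  refine hK.induction_on (p := fun S => ∃ r > (0 : ℝ), ∃ δ > (0 : ℝ), ∃ L > (0 : ℝ),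
    ∀ z ∈ S, LocalBounds X (ball z r) δ L) ?_ ?_ ?_ ?_
  · exact ⟨1, one_pos, 1, one_pos, 1, one_pos, by simp⟩
  · rintro S T hST ⟨r, hr, δ, hδ, L, hL, hT⟩
    exact ⟨r, hr, δ, hδ, L, hL, fun z hz => hT z (hST hz)⟩
  · rintro S T ⟨r, hr, δ, hδ, L, hL, hS⟩ ⟨r', hr', δ', hδ', L', hL', hT⟩
    refine ⟨min r r', by positivity, min δ δ', by positivity, max L L', by positivity, ?_⟩
    rintro z (hz | hz)
    · exact (hS z hz).mono (ball_subset_ball (min_le_left _ _)) (min_le_left _ _)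
        (le_max_left _ _)
    · exact (hT z hz).mono (ball_subset_ball (min_le_right _ _)) (min_le_right _ _)
        (le_max_right _ _)
  · intro z hz
    obtain ⟨r, hr, δ, hδ, L, hL, hz⟩ := h z hz
    refine ⟨ball z (r / 2), mem_nhdsWithin_of_mem_nhds (ball_mem_nhds z (by positivity)),
      r / 2, by positivity, δ, hδ, L, hL, fun y hy => hz.mono ?_ le_rfl le_rfl⟩
    refine ball_subset_ball' ?_
    rw [mem_ball] at hy
    linarith

/-- The curve `σ` solves `X` at every time in `S`. -/
def SolvesOn (X : M → ℝ → M) (σ : ℝ → M) (S : Set ℝ) : Prop :=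
  ContinuousOn σ S ∧
    ∀ t ∈ S, (fun h : ℝ => dist (σ (t + h)) (X (σ t) h)) =o[𝓝 (0 : ℝ)] fun h => h

theorem SolvesOn.mono {X : M → ℝ → M} {σ : ℝ → M} {S T : Set ℝ} (h : SolvesOn X σ S)
    (hT : T ⊆ S) : SolvesOn X σ T :=
  ⟨h.1.mono hT, fun t ht => h.2 t (hT ht)⟩

theorem SolvesOn.comp_const_add {X : M → ℝ → M} {σ : ℝ → M} {S : Set ℝ} (h : SolvesOn X σ S)
    (c : ℝ) : SolvesOn X (fun t => σ (c + t)) ((fun t => c + t) ⁻¹' S) := by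
  refine ⟨h.1.comp (by fun_prop) (mapsTo_preimage _ _), fun t ht => ?_⟩
  simpa only [add_assoc] using h.2 (c + t) ht

theorem SolvesOn.comp_neg {X : M → ℝ → M} {σ : ℝ → M} {S : Set ℝ} (h : SolvesOn X σ S) :
    SolvesOn (fun x t => X x (-t)) (fun t => σ (-t)) (Neg.neg ⁻¹' S) := by
  refine ⟨h.1.comp (by fun_prop) (mapsTo_preimage _ _), fun t ht => ?_⟩
  have hneg : Tendsto (fun u : ℝ => -u) (𝓝 0) (𝓝 0) := by
    simpa using (continuous_neg (G := ℝ)).tendsto 0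
  have := ((h.2 (-t) ht).comp_tendsto hneg).neg_right
  simpa only [Function.comp_def, neg_add, neg_neg] using this

theorem SolvesOn.eventually_dist_le {X : M → ℝ → M} {σ : ℝ → M} {S : Set ℝ}
    (h : SolvesOn X σ S) {t : ℝ} (ht : t ∈ S) {η : ℝ} (hη : 0 < η) :
    ∀ᶠ u in 𝓝[>] (0 : ℝ), dist (σ (t + u)) (X (σ t) u) ≤ η * u := by
  filter_upwards [((h.2 t ht).bound hη).filter_mono nhdsWithin_le_nhds, self_mem_nhdsWithin]
    with u hu hu0
  rwa [Real.norm_of_nonneg dist_nonneg, Real.norm_of_nonneg (le_of_lt hu0)] at hu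

theorem IsSolutionCurve.solvesOn {X : M → ℝ → M} {I : Set ℝ} {σ : ℝ → M} {x : M}
    (h : IsSolutionCurve X I σ x) : SolvesOn X σ I :=
  ⟨h.cont, h.tangent⟩

theorem IsSolutionCurve.reverse {X : M → ℝ → M} {I : Set ℝ} {σ : ℝ → M} {x : M}
    (h : IsSolutionCurve X I σ x) :
    IsSolutionCurve (fun x t => X x (-t)) (Neg.neg ⁻¹' I) (fun t => σ (-t)) x where
  isOpen := h.isOpen.preimage continuous_neg
  ordConnected := ⟨fun a ha b hb c hc =>
    h.ordConnected.out hb ha ⟨neg_le_neg hc.2, neg_le_neg hc.1⟩⟩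
  zero_mem := by simpa using h.zero_mem
  init := by simpa using h.init
  cont := h.solvesOn.comp_neg.1
  tangent := h.solvesOn.comp_neg.2

theorem gronwallBound_le_mul_exp {K ε δ x : ℝ} (hK : 0 < K) (hε : 0 ≤ ε) :
    gronwallBound δ K ε x ≤ (δ + ε * x) * Real.exp (K * x) := by
  rw [gronwallBound_of_K_ne_0 hK.ne']
  have h : Real.exp (K * x) - 1 ≤ K * x * Real.exp (K * x) := by
    have h₁ := Real.add_one_le_exp (-(K * x))
    have h₂ : Real.exp (-(K * x)) * Real.exp (K * x) = 1 := by
      rw [← Real.exp_add]; simp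
    nlinarith [Real.exp_pos (K * x)]
  have : ε / K * (Real.exp (K * x) - 1) ≤ ε / K * (K * x * Real.exp (K * x)) := by gcongr
  have h₃ : ε / K * (K * x * Real.exp (K * x)) = ε * x * Real.exp (K * x) := by field_simp
  linarith

/-- Grönwall's inequality when the differential inequality is known only below the level `R`. -/
theorem le_mul_exp_of_eventually_le_of_lt {g : ℝ → ℝ} {a b K ε R : ℝ} (hK : 0 < K) (hε : 0 ≤ ε)
    (hg : ContinuousOn g (Icc a b)) (ha : 0 ≤ g a)
    (hslope : ∀ t ∈ Ico a b, g t < R → ∀ η > 0, ∀ᶠ h in 𝓝[>] (0 : ℝ),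
      g (t + h) ≤ g t + h * (K * g t + ε + η))
    (hR : (g a + ε * (b - a)) * Real.exp (K * (b - a)) < R) {t : ℝ} (ht : t ∈ Icc a b) :
    g t ≤ (g a + ε * (b - a)) * Real.exp (K * (b - a)) := by
  have hab : 0 ≤ b - a := by linarith [ht.1, ht.2]
  have hR0 : 0 < R := lt_of_le_of_lt (by positivity) hR
  have key : ∀ t ∈ Icc a b, min (g t) R ≤ gronwallBound (g a) K ε (t - a) := by
    refine le_gronwallBound_of_liminf_deriv_right_le (f' := fun t => K * min (g t) R + ε)
      (by fun_prop) ?_ (min_le_left _ _) (fun _ _ => le_rfl)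
    intro x hx r hr
    have htend : Tendsto (fun z => z - x) (𝓝[>] x) (𝓝[>] 0) := by
      refine tendsto_nhdsWithin_iff.2 ⟨?_, ?_⟩
      · have : Tendsto (fun z : ℝ => z - x) (𝓝 x) (𝓝 0) := by
          simpa using (continuous_sub_right x).tendsto x
        exact this.mono_left nhdsWithin_le_nhds
      · filter_upwards [self_mem_nhdsWithin] with z hz
        exact sub_pos.2 (mem_Ioi.1 hz)
    refine Eventually.frequently ?_
    rcases lt_or_ge (g x) R with hgx | hgx
    · rw [min_eq_left hgx.le] at hr
      have hη : 0 < (r - (K * g x + ε)) / 2 := by linarith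
      filter_upwards [htend.eventually (hslope x hx hgx _ hη), self_mem_nhdsWithin] with z hz hzx
      have hzx' : 0 < z - x := sub_pos.2 hzx
      rw [add_sub_cancel] at hz
      rw [min_eq_left hgx.le, inv_mul_lt_iff₀ hzx']
      have := min_le_left (g z) R
      nlinarith
    · rw [min_eq_right hgx] at hr
      have hr0 : 0 < r := lt_of_le_of_lt (by positivity) hr
      filter_upwards [self_mem_nhdsWithin] with z hzx
      have hzx' : 0 < z - x := sub_pos.2 hzx
      rw [min_eq_right hgx, inv_mul_lt_iff₀ hzx']
      have := min_le_right (g z) R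
      nlinarith
  have hbound : gronwallBound (g a) K ε (t - a) ≤
      (g a + ε * (b - a)) * Real.exp (K * (b - a)) :=
    (gronwallBound_mono ha hε hK.le (sub_le_sub_right ht.2 a)).trans
      (gronwallBound_le_mul_exp hK hε)
  have := (key t ht).trans hbound
  rcases min_le_iff.1 this with h | h
  · exact h
  · linarith

/-- Solutions that stay in a common region of validity of E1 separate at most exponentially. -/
theorem SolvesOn.dist_le_mul_exp {X : M → ℝ → M} {σ τ : ℝ → M} {a b δ L R : ℝ}
    (hL : 0 < L) (hδ : 0 < δ)
    (hσ : SolvesOn X σ (Icc a b)) (hτ : SolvesOn X τ (Icc a b))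
    (hX : ∀ t ∈ Icc a b, dist (σ t) (τ t) < R →
      ∃ U, σ t ∈ U ∧ τ t ∈ U ∧ LocalBounds X U δ L)
    (hR : dist (σ a) (τ a) * Real.exp (L * (b - a)) < R) {t : ℝ} (ht : t ∈ Icc a b) :
    dist (σ t) (τ t) ≤ dist (σ a) (τ a) * Real.exp (L * (b - a)) := by
  have := le_mul_exp_of_eventually_le_of_lt (g := fun t => dist (σ t) (τ t)) (ε := 0) hL le_rfl
    (continuous_dist.comp_continuousOn (hσ.1.prodMk hτ.1)) dist_nonneg ?_ (by simpa using hR) ht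
  · simpa using this
  intro u hu hlt η hη
  have hu' := Ico_subset_Icc_self hu
  obtain ⟨U, hσU, hτU, hU⟩ := hX u hu' hlt
  have hsmall : ∀ᶠ h in 𝓝[>] (0 : ℝ), h < δ := nhdsWithin_le_nhds (Iio_mem_nhds hδ)
  filter_upwards [hσ.eventually_dist_le hu' (half_pos hη), hτ.eventually_dist_le hu' (half_pos hη),
    hsmall, self_mem_nhdsWithin] with h h₁ h₂ h₃ h₄
  have h₄' : 0 < h := h₄
  have h₅ := hU.lipschitz _ hσU _ hτU h (by rwa [abs_of_pos h₄'])
  rw [abs_of_pos h₄'] at h₅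
  rw [dist_comm] at h₂
  have := dist_triangle4 (σ (u + h)) (X (σ u) h) (X (τ u) h) (τ (u + h))
  linarith

theorem SolvesOn.dist_le_mul_exp_backward {X : M → ℝ → M} {σ τ : ℝ → M} {a b δ L R : ℝ}
    (hL : 0 < L) (hδ : 0 < δ)
    (hσ : SolvesOn X σ (Icc a b)) (hτ : SolvesOn X τ (Icc a b))
    (hX : ∀ t ∈ Icc a b, dist (σ t) (τ t) < R →
      ∃ U, σ t ∈ U ∧ τ t ∈ U ∧ LocalBounds X U δ L)
    (hR : dist (σ b) (τ b) * Real.exp (L * (b - a)) < R) {t : ℝ} (ht : t ∈ Icc a b) :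
    dist (σ t) (τ t) ≤ dist (σ b) (τ b) * Real.exp (L * (b - a)) := by
  have hsub : Icc (-b) (-a) ⊆ Neg.neg ⁻¹' Icc a b := fun u hu =>
    ⟨le_neg.2 hu.2, neg_le.2 hu.1⟩
  have := (hσ.comp_neg.mono hsub).dist_le_mul_exp (R := R) (t := -t) hL hδ
    (hτ.comp_neg.mono hsub)
    (fun u hu h => by
      obtain ⟨U, h₁, h₂, hU⟩ := hX (-u) (hsub hu) h
      exact ⟨U, h₁, h₂, hU.reverse⟩)
    (by simpa [neg_add_eq_sub] using hR) ⟨neg_le_neg ht.2, neg_le_neg ht.1⟩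
  simpa [neg_add_eq_sub] using this

/-- Solutions are tangent to the arc field to second order, with uniform constants. -/
theorem SolvesOn.dist_arc_le_of_nonneg {X : M → ℝ → M} (hX0 : ∀ x, X x 0 = x) {σ : ℝ → M}
    {T δ L ρ : ℝ} (hL : 0 < L) (hT : 0 ≤ T) (hTδ : T < δ) (hσ : SolvesOn X σ (Icc 0 T))
    (hX : LocalBounds X (ball (σ 0) ρ) δ L) (hTρ : L * T < ρ / 2)
    (hTρ' : L * T * T * Real.exp (L * T) < ρ / 2) :
    dist (σ T) (X (σ 0) T) ≤ L * T * T * Real.exp (L * T) := by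
  set z := σ 0 with hz
  have hδ : 0 < δ := hT.trans_lt hTδ
  have hρ : 0 < ρ := by nlinarith [mul_nonneg hL.le hT]
  have hzball : z ∈ ball z ρ := mem_ball_self hρ
  have habs : ∀ t ∈ Icc 0 T, |t| < δ := fun t ht => by
    rw [abs_of_nonneg ht.1]; exact ht.2.trans_lt hTδ
  have hcont : ContinuousOn (X z) (Icc 0 T) := by
    refine LipschitzOnWith.continuousOn (K := ⟨L, hL.le⟩) ?_
    refine LipschitzOnWith.of_dist_le_mul fun u hu v hv => ?_
    exact hX.speed z hzball u v (habs u hu) (habs v hv)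
  have harc : ∀ t ∈ Icc 0 T, dist (X z t) z < ρ / 2 := fun t ht => by
    have := hX.speed z hzball t 0 (habs t ht) (by simpa using hδ)
    rw [hX0, sub_zero, abs_of_nonneg ht.1] at this
    nlinarith [ht.2]
  have hz0 : dist (σ 0) (X z 0) = 0 := by rw [hX0, ← hz, dist_self]
  have := le_mul_exp_of_eventually_le_of_lt (g := fun t => dist (σ t) (X z t)) (ε := L * T)
    (R := ρ / 2) hL (by positivity) (continuous_dist.comp_continuousOn (hσ.1.prodMk hcont)) dist_nonneg ?_
    (by simpa [hz0] using hTρ') (right_mem_Icc.2 hT)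
  · simpa [hz0] using this
  intro u hu hlt η hη
  have hu' := Ico_subset_Icc_self hu
  have hsmall : ∀ᶠ h in 𝓝[>] (0 : ℝ), h < δ := nhdsWithin_le_nhds (Iio_mem_nhds hδ)
  filter_upwards [hσ.eventually_dist_le hu' hη, hsmall, self_mem_nhdsWithin] with h h₁ h₃ h₄
  have h₄' : 0 < h := h₄
  have hhδ : |h| < δ := by rwa [abs_of_pos h₄']
  have hXu := harc u hu'
  have hσu : σ u ∈ ball z ρ := by
    rw [mem_ball]
    linarith [dist_triangle (σ u) (X z u) z]
  have h₅ := hX.lipschitz _ hσu (X z u) (by rw [mem_ball]; linarith) h hhδ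
  have h₆ := hX.semigroup z hzball u h (habs u hu') hhδ
  rw [abs_of_nonneg (mul_nonneg hu'.1 h₄'.le)] at h₆
  rw [abs_of_pos h₄'] at h₅
  rw [dist_comm] at h₆
  have h₇ : u * h * L ≤ T * h * L := by gcongr; exact hu'.2
  have := dist_triangle4 (σ (u + h)) (X (σ u) h) (X (X z u) h) (X z (u + h))
  linarith

theorem SolvesOn.dist_arc_le {X : M → ℝ → M} (hX0 : ∀ x, X x 0 = x) {σ : ℝ → M}
    {c t δ L ρ : ℝ} (hL : 0 < L) (htδ : |t| < δ) (hσ : SolvesOn X σ (uIcc c (c + t)))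
    (hX : LocalBounds X (ball (σ c) ρ) δ L) (htρ : L * |t| < ρ / 2)
    (htρ' : L * |t| * |t| * Real.exp (L * |t|) < ρ / 2) :
    dist (σ (c + t)) (X (σ c) t) ≤ L * |t| * |t| * Real.exp (L * |t|) := by
  have hshift := hσ.comp_const_add c
  rcases le_total 0 t with ht | ht
  · have hsub : Icc 0 t ⊆ (fun u => c + u) ⁻¹' uIcc c (c + t) := fun u hu => by
      simp only [mem_preimage]
      rw [uIcc_of_le (by linarith)]
      exact ⟨by linarith [hu.1], by linarith [hu.2]⟩
    rw [abs_of_nonneg ht] at *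
    simpa using (hshift.mono hsub).dist_arc_le_of_nonneg hX0 hL ht htδ
      (by simpa using hX) htρ htρ'
  · have hsub : Icc 0 (-t) ⊆ Neg.neg ⁻¹' ((fun u => c + u) ⁻¹' uIcc c (c + t)) := fun u hu => by
      simp only [mem_preimage]
      rw [uIcc_of_ge (by linarith)]
      exact ⟨by linarith [hu.2], by linarith [hu.1]⟩
    rw [abs_of_nonpos ht] at *
    simpa using (hshift.comp_neg.mono hsub).dist_arc_le_of_nonneg (by simpa using hX0) hL
      (neg_nonneg.2 ht) htδ (by simpa using hX.reverse) htρ htρ'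

set_option maxHeartbeats 600000 in
/-- The second-order estimate for `F_{-s} ∘ X_t ∘ F_s` along a solution `p` with starting point
`p 0`, end point `p s` and uniform bounds for `X` near its trace; `q` solves `X` from
`X_t (p s)`. -/
theorem SolvesOn.dist_pullback_le {X : M → ℝ → M} (hX0 : ∀ x, X x 0 = x) {p q : ℝ → M}
    {s t δ L ρ H : ℝ} (hδ : 0 < δ) (hL : 0 < L) (hp : SolvesOn X p (Icc 0 s))
    (hq : SolvesOn X q (Icc (-s) 0)) (hq0 : q 0 = X (p s) t)
    (hX : ∀ u ∈ Icc 0 s, LocalBounds X (ball (p u) ρ) δ L)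
    (hH : H = L * (Real.exp L + 1) * (Real.exp (L * s) + 1) * (1 + L))
    (ht0 : t ≠ 0) (htδ : |t| < δ) (hts : |t| < s) (ht1 : |t| < 1) (htρ : H * |t| < ρ / 4) :
    dist (q (-s)) (X (p 0) t) ≤ H * |t| * |t| := by
  set A := Real.exp L with hA
  set E := Real.exp (L * s) with hE
  have hT : 0 < |t| := abs_pos.2 ht0
  have hs : 0 < s := hT.trans hts
  have hA1 : 1 ≤ A := Real.one_le_exp hL.le
  have hE1 : 1 ≤ E := Real.one_le_exp (by positivity)
  have hexp : Real.exp (L * |t|) ≤ A := Real.exp_le_exp.2 (by nlinarith)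
  have hexpE : ∀ v ≤ s, Real.exp (L * v) ≤ E := fun v hv => Real.exp_le_exp.2 (by nlinarith)
  have hHeq : L * ((A + 1) * E + A) + L ≤ H ∧ L * A + L * A * E * (1 + L) ≤ H := by
    rw [hH]
    have h₁ : 0 ≤ L * A := by positivity
    have h₂ : 0 ≤ L * E := by positivity
    have h₃ : 0 ≤ L * A * E := by positivity
    have h₄ : 0 ≤ L * L := by positivity
    have h₅ : 0 ≤ L * L * A := by positivity
    have h₆ : 0 ≤ L * L * E := by positivity
    have h₇ : 0 ≤ L * L * A * E := by positivity
    constructor <;> nlinarith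
  obtain ⟨hHa, hHb⟩ := hHeq
  have hTT : |t| * |t| ≤ |t| := by nlinarith
  have hρ : 0 < ρ := by
    have : 0 ≤ H * |t| := by rw [hH]; positivity
    linarith
  have hHTT : H * (|t| * |t|) < ρ / 4 := by
    have hH0 : 0 ≤ H := by rw [hH]; positivity
    nlinarith
  have hLH : L ≤ H := by nlinarith [mul_pos hL (by positivity : 0 < (A + 1) * E + A)]
  have hLT : L * |t| < ρ / 4 := by nlinarith
  have hLA : L * |t| * |t| * Real.exp (L * |t|) ≤ L * A * (|t| * |t|) := by
    nlinarith [mul_le_mul_of_nonneg_left hexp (by positivity : 0 ≤ L * (|t| * |t|))]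
  have hLAH : L * A * (|t| * |t|) ≤ H * (|t| * |t|) := by
    gcongr
    nlinarith [(by positivity : 0 ≤ L * A * E * (1 + L))]
  have hss : s ∈ Icc 0 s := right_mem_Icc.2 hs.le
  have h0s : (0 : ℝ) ∈ Icc 0 s := left_mem_Icc.2 hs.le
  have hw : dist (q 0) (p s) < ρ / 4 := by
    have := (hX s hss).speed (p s) (mem_ball_self hρ) t 0 htδ (by simpa using hδ)
    rw [hX0, sub_zero, ← hq0] at this
    linarith
  have hqshift : SolvesOn X (fun u => q (-(s + t) + u)) (Icc t (s + t)) :=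
    (hq.comp_const_add _).mono fun u hu => ⟨by linarith [hu.1], by linarith [hu.2]⟩
  have hcommon : ∀ u ∈ Icc 0 s, dist (q (-(s + t) + u)) (p u) < ρ →
      ∃ U, q (-(s + t) + u) ∈ U ∧ p u ∈ U ∧ LocalBounds X U δ L := fun u hu h =>
    ⟨ball (p u) ρ, h, mem_ball_self hρ, hX u hu⟩
  rcases lt_or_gt_of_ne ht0 with ht | ht
  · have habs : |t| = -t := abs_of_neg ht
    have hst : 0 ≤ s + t := by linarith
    have h₁ : dist (p (s + t)) (q 0) ≤ L * A * (|t| * |t|) := by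
      rw [hq0]
      refine (SolvesOn.dist_arc_le hX0 hL htδ (hp.mono ?_) (hX s hss)
        (by linarith) (by linarith)).trans hLA
      rw [uIcc_of_ge (by linarith)]
      exact Icc_subset_Icc hst le_rfl
    have hend : dist (q (-(s + t) + (s + t))) (p (s + t)) = dist (p (s + t)) (q 0) := by
      rw [neg_add_cancel, dist_comm]
    have h₂ : dist (p (s + t)) (q 0) * Real.exp (L * (s + t - 0)) ≤
        L * A * E * (|t| * |t|) := by
      calc _ ≤ L * A * (|t| * |t|) * E := by
            gcongr
            exact hexpE _ (by linarith)
        _ = _ := by ring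
    have h₂H : L * A * E * (|t| * |t|) ≤ H * (|t| * |t|) := by
      gcongr
      nlinarith [(by positivity : 0 ≤ L * A * E * L), (by positivity : 0 ≤ L * A)]
    have h₃ : dist (q (-(s + t))) (p 0) ≤ L * A * E * (|t| * |t|) := by
      have := SolvesOn.dist_le_mul_exp_backward (R := ρ) (t := 0) hL hδ
        (hqshift.mono (Icc_subset_Icc ht.le le_rfl))
        (hp.mono (Icc_subset_Icc le_rfl (by linarith)))
        (fun u hu => hcommon u ⟨hu.1, by linarith [hu.2]⟩)
        (by rw [hend]; linarith) (left_mem_Icc.2 hst)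
      rw [hend, add_zero] at this
      exact this.trans h₂
    have hv : LocalBounds X (ball (q (-(s + t))) (ρ / 2)) δ L :=
      (hX 0 h0s).mono (ball_subset_ball' (by linarith)) le_rfl le_rfl
    have h₄ : dist (q (-s)) (X (q (-(s + t))) t) ≤ L * A * (|t| * |t|) := by
      have := SolvesOn.dist_arc_le (c := -(s + t)) hX0 hL htδ (hq.mono ?_) hv
        (by linarith) (by linarith)
      · rw [neg_add, neg_add_cancel_right, ← neg_add] at this
        exact this.trans hLA
      · rw [uIcc_of_ge (by linarith)]
        exact Icc_subset_Icc (by linarith) (by linarith)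
    have h₅ := (hX 0 h0s).lipschitz (q (-(s + t))) (by rw [mem_ball]; linarith) (p 0)
      (mem_ball_self hρ) t htδ
    have h₆ : dist (q (-(s + t))) (p 0) * (1 + |t| * L) ≤
        L * A * E * (|t| * |t|) * (1 + L) := by
      gcongr
      nlinarith
    have h₇ := mul_le_mul_of_nonneg_right hHb (by positivity : 0 ≤ |t| * |t|)
    have := dist_triangle (q (-s)) (X (q (-(s + t))) t) (X (p 0) t)
    linarith
  · have habs : |t| = t := abs_of_pos ht
    have hst : t ≤ s := by linarith
    have hw' : LocalBounds X (ball (q 0) (ρ / 2)) δ L :=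
      (hX s hss).mono (ball_subset_ball' (by linarith)) le_rfl le_rfl
    have h₁ : dist (q (-t)) (X (q 0) (-t)) ≤ L * A * (|t| * |t|) := by
      have := SolvesOn.dist_arc_le (c := 0) (t := -t) hX0 hL (by rwa [abs_neg]) (hq.mono ?_) hw'
        (by rw [abs_neg]; linarith) (by rw [abs_neg]; linarith)
      · rw [zero_add, abs_neg] at this
        exact this.trans hLA
      · rw [uIcc_of_ge (by linarith)]
        exact Icc_subset_Icc (by linarith) le_rfl
    have h₂ : dist (p s) (X (q 0) (-t)) ≤ L * (|t| * |t|) := by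
      have := (hX s hss).semigroup (p s) (mem_ball_self hρ) t (-t) htδ (by rwa [abs_neg])
      rw [add_neg_cancel, hX0, ← hq0, abs_mul, abs_neg] at this
      linarith
    have h₃ : dist (q (-t)) (p s) ≤ L * (A + 1) * (|t| * |t|) := by
      rw [dist_comm] at h₂
      linarith [dist_triangle (q (-t)) (X (q 0) (-t)) (p s)]
    have hend : dist (q (-(s + t) + s)) (p s) = dist (q (-t)) (p s) := by
      congr 2; ring
    have h₄ : dist (q (-t)) (p s) * Real.exp (L * (s - t)) ≤
        L * (A + 1) * E * (|t| * |t|) := by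
      calc _ ≤ L * (A + 1) * (|t| * |t|) * E := by
            gcongr
            exact hexpE _ (by linarith)
        _ = _ := by ring
    have h₄H : L * (A + 1) * E * (|t| * |t|) ≤ H * (|t| * |t|) := by
      gcongr
      nlinarith [(by positivity : 0 ≤ L * A)]
    have h₅ : dist (q (-s)) (p t) ≤ L * (A + 1) * E * (|t| * |t|) := by
      have := SolvesOn.dist_le_mul_exp_backward (R := ρ) (t := t) hL hδ
        (hqshift.mono (Icc_subset_Icc le_rfl (by linarith)))
        (hp.mono (Icc_subset_Icc ht.le le_rfl))
        (fun u hu => hcommon u ⟨by linarith [hu.1], hu.2⟩)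
        (by rw [hend]; linarith) (left_mem_Icc.2 hst)
      rw [hend, neg_add, neg_add_cancel_right] at this
      exact this.trans h₄
    have h₆ : dist (p t) (X (p 0) t) ≤ L * A * (|t| * |t|) := by
      have := SolvesOn.dist_arc_le (c := 0) hX0 hL htδ (hp.mono ?_) (hX 0 h0s)
        (by linarith) (by linarith)
      · rw [zero_add] at this
        exact this.trans hLA
      · rw [uIcc_of_le (by linarith)]
        exact Icc_subset_Icc le_rfl (by linarith)
    have h₇ := mul_le_mul_of_nonneg_right hHa (by positivity : 0 ≤ |t| * |t|)
    have h₈ : 0 ≤ L * (|t| * |t|) := by positivity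
    have := dist_triangle (q (-s)) (p t) (X (p 0) t)
    linarith

theorem pullback_along_flow_tangent_of_pos {X : M → ℝ → M} (hX0 : ∀ x, X x 0 = x)
    (hX : ∀ z, ∃ r > (0 : ℝ), ∃ δ > (0 : ℝ), ∃ L > (0 : ℝ), LocalBounds X (ball z r) δ L)
    {I : M → Set ℝ} {F : M → ℝ → M} (hF : ∀ x, IsSolutionCurve X (I x) (F x) x)
    {s : ℝ} (hs : 0 < s) {x₀ : M} (hsx₀ : s ∈ I x₀) :
    ∃ r > (0 : ℝ), ∀ ε > (0 : ℝ), ∃ δ > (0 : ℝ), ∀ x ∈ ball x₀ r, s ∈ I x →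
      ∀ t : ℝ, 0 < |t| → |t| < δ → (-s) ∈ I (X (F x s) t) →
        dist (F (X (F x s) t) (-s)) (X x t) ≤ ε * |t| := by
  have hpos : ∀ x, s ∈ I x → SolvesOn X (F x) (Icc 0 s) := fun x hx =>
    (hF x).solvesOn.mono ((hF x).ordConnected.out (hF x).zero_mem hx)
  have hneg : ∀ x, -s ∈ I x → SolvesOn X (F x) (Icc (-s) 0) := fun x hx =>
    (hF x).solvesOn.mono ((hF x).ordConnected.out hx (hF x).zero_mem)
  obtain ⟨r, hr, δ, hδ, L, hL, hbd⟩ :=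
    (isCompact_Icc.image_of_continuousOn (hpos x₀ hsx₀).1).exists_localBounds fun z _ => hX z
  refine ⟨r / 4 / Real.exp (L * s), by positivity, fun ε hε => ?_⟩
  set H := L * (Real.exp L + 1) * (Real.exp (L * s) + 1) * (1 + L) with hH
  have hH0 : 0 < H := by positivity
  refine ⟨min (min δ s) (min 1 (min (r / 2 / 4 / H) (ε / H))), by positivity, ?_⟩
  intro x hx hsx t ht0 ht hw
  simp only [lt_min_iff, lt_div_iff₀ hH0] at ht
  obtain ⟨⟨htδ, hts⟩, ht1, htρ, htε⟩ := ht
  rw [mem_ball, lt_div_iff₀ (Real.exp_pos _)] at hx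
  have hnear : ∀ u ∈ Icc 0 s, LocalBounds X (ball (F x u) (r / 2)) δ L := fun u hu => by
    have hstart : dist (F x 0) (F x₀ 0) * Real.exp (L * (s - 0)) < r / 4 := by
      rwa [(hF x).init, (hF x₀).init, sub_zero]
    have := (hpos x hsx).dist_le_mul_exp hL hδ (hpos x₀ hsx₀)
      (fun v hv h => ⟨ball (F x₀ v) r, by rw [mem_ball]; linarith, mem_ball_self hr,
        hbd _ (mem_image_of_mem _ hv)⟩) hstart hu
    exact (hbd _ (mem_image_of_mem _ hu)).mono (ball_subset_ball' (by linarith)) le_rfl le_rfl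
  have := (hpos x hsx).dist_pullback_le hX0 hδ hL (hneg _ hw) (hF _).init hnear hH
    (abs_pos.1 ht0) htδ hts ht1 (by linarith)
  rw [(hF x).init] at this
  refine this.trans ?_
  gcongr
  linarith

/-- for an arc field `X` satisfying E1 and E2 with local flow `F`,
the pull-back `(F_s)* X` is locally uniformly tangent to `X` wherever defined. -/
theorem pullback_along_flow_tangent
    {M : Type*} [MetricSpace M] (hM : LocallyComplete M)
    (X : M → ℝ → M) (hX : IsArcField X) (hE1 : CondE1 X) (hE2 : CondE2 X)
    (I : M → Set ℝ) (F : M → ℝ → M)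
    (hF : ∀ x : M, IsSolutionCurve X (I x) (F x) x ∧
      ∀ (J : Set ℝ) (τ : ℝ → M), IsSolutionCurve X J τ x →
        J ⊆ I x ∧ Set.EqOn τ (F x) J) :
    ∀ s : ℝ, ∀ x₀ : M, s ∈ I x₀ → ∃ r > (0 : ℝ), ∀ ε > (0 : ℝ), ∃ δ > (0 : ℝ),
      ∀ x ∈ Metric.ball x₀ r, s ∈ I x → ∀ t : ℝ, 0 < |t| → |t| < δ →
        (-s) ∈ I (X (F x s) t) →
          dist (F (X (F x s) t) (-s)) (X x t) ≤ ε * |t| := by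
  intro s x₀ hs
  have hsol := fun x => (hF x).1
  have hbd := exists_localBounds_ball hX hE1 hE2
  rcases lt_trichotomy s 0 with hs0 | rfl | hs0
  · obtain ⟨r, hr, h⟩ := pullback_along_flow_tangent_of_pos (X := fun x t => X x (-t))
      (by simpa using hX.2.1)
      (fun z => by
        obtain ⟨r, hr, δ, hδ, L, hL, hz⟩ := hbd z
        exact ⟨r, hr, δ, hδ, L, hL, hz.reverse⟩)
      (fun x => (hsol x).reverse) (neg_pos.2 hs0) (x₀ := x₀) (by simpa using hs)
    refine ⟨r, hr, fun ε hε => ?_⟩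
    obtain ⟨δ, hδ, h⟩ := h ε hε
    refine ⟨δ, hδ, fun x hx hsx t ht htδ hw => ?_⟩
    simpa using h x hx (by simpa using hsx) (-t) (by simpa using ht) (by simpa using htδ)
      (by simpa using hw)
  · refine ⟨1, one_pos, fun ε hε => ⟨1, one_pos, fun x _ _ t _ _ _ => ?_⟩⟩
    rw [neg_zero, (hsol _).init, (hsol x).init, dist_self]
    positivity
  · exact pullback_along_flow_tangent_of_pos hX.2.1 hbd hsol hs0 hs
end
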